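/- Let (R,m) be a Noetherian local ring, I an ideal, N a finitely generated R-module, k ≥ -1 an integer, and r = depth_k(I,N). If r < ∞, then for every integer j ≤ r, the set {p ∈ Ass_R(H^j_I(N)) : dim(R/p) ≥ k} is finite. -/

import Mathlib

open CategoryTheory Opposite IsLocalRing

/-- Interpretation of an integer `k ≥ -1` in `WithBot ℕ∞`, for comparison with Krull dimensions. -/
noncomputable def zdim (k : ℤ) : WithBot (WithTop ℕ) :=
  if k < 0 then ⊥ else ((k.toNat : WithTop ℕ) : WithBot (WithTop ℕ))

/-- The ideal generated by the first `j` entries of the sequence `x`. -/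
def prefIdeal {R : Type} [CommRing R] {r : ℕ} (x : Fin r → R) (j : ℕ) : Ideal R :=
  Ideal.span (x '' {i | (i : ℕ) < j})

/-- `x` is an `N`-sequence in dimension `> k`: for each `i`, `x i` avoids every associated
prime `p` of `N/(x_0,…,x_{i-1})N` with `dim(R/p) > k`. -/
def IsSeqInDimGT (R : Type) [CommRing R] (N : Type) [AddCommGroup N] [Module R N]
    (k : ℤ) {r : ℕ} (x : Fin r → R) : Prop :=
  ∀ i : Fin r, ∀ p ∈ associatedPrimes R (N ⧸ (prefIdeal x (i : ℕ) • ⊤ : Submodule R N)),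
    zdim k < ringKrullDim (R ⧸ p) → x i ∉ p

/-- `depth_k(I,N)`: the common length of maximal `N`-sequences in dimension `> k`
contained in `I` (realized as the supremum of lengths of such sequences). -/
noncomputable def depthK (R : Type) [CommRing R] (k : ℤ) (I : Ideal R)
    (N : Type) [AddCommGroup N] [Module R N] : ℕ∞ :=
  sSup {n : ℕ∞ | ∃ (r : ℕ) (x : Fin r → R),
    (∀ i, x i ∈ I) ∧ IsSeqInDimGT R N k x ∧ n = (r : ℕ∞)}

/-- The set of prime (or arbitrary) ideals `p` with `dim(R/p) ≥ k`. -/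
def dimGE (R : Type) [CommRing R] (k : ℤ) : Set (Ideal R) :=
  {p | zdim k ≤ ringKrullDim (R ⧸ p)}

namespace ComplexCohomology

variable {R : Type} [CommRing R] {P : ℕ → Type} [∀ i, AddCommGroup (P i)] [∀ i, Module R (P i)]

/-- The coboundaries `P i → M` of the cochain complex `Hom(P, M)`. -/
def coboundaries (d : ∀ i, P (i + 1) →ₗ[R] P i) (M : Type) [AddCommGroup M] [Module R M] :
    ∀ i, Submodule R (P i →ₗ[R] M)
  | 0 => ⊥
  | i + 1 => LinearMap.range (LinearMap.lcomp R M (d i))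

/-- A tower of modules `Q 0 → Q 1 → ⋯ → Q n` in which `Q (a + 1) = Q a / x a Q a` and `x a` is
injective on `Q a` locally at `p`. -/
structure IsLocallyRegularTower (p : Ideal R) (Q : ℕ → Type) [∀ a, AddCommGroup (Q a)]
    [∀ a, Module R (Q a)] (π : ∀ a, Q a →ₗ[R] Q (a + 1)) (x : ℕ → R) (n : ℕ) : Prop where
  surjective : ∀ a < n, Function.Surjective (π a)
  map_eq_zero_iff : ∀ a < n, ∀ m, π a m = 0 ↔ ∃ m', x a • m' = m
  regular : ∀ a < n, ∃ s ∉ p, ∀ m : Q a, x a • m = 0 → s • m = 0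

lemma exists_smul_eq_of_forall_exists {F M : Type} [AddCommGroup F] [Module R F]
    [AddCommGroup M] [Module R M] [Module.Projective R F] (x : R) (g : F →ₗ[R] M)
    (hg : ∀ y, ∃ m, x • m = g y) : ∃ k : F →ₗ[R] M, g = x • k := by
  obtain ⟨k, hk⟩ := Module.projective_lifting_property
    (LinearMap.lsmul R M x).rangeRestrict
    (g.codRestrict (LinearMap.range (LinearMap.lsmul R M x))
      fun y ↦ by obtain ⟨m, hm⟩ := hg y; exact ⟨m, hm⟩)
    (LinearMap.surjective_rangeRestrict _)
  refine ⟨k, ?_⟩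
  ext y
  have := congrArg Subtype.val (LinearMap.congr_fun hk y)
  simpa using this.symm

variable {d : ∀ i, P (i + 1) →ₗ[R] P i} {p : Ideal R} {Q : ℕ → Type} [∀ a, AddCommGroup (Q a)]
  [∀ a, Module R (Q a)] {π : ∀ a, Q a →ₗ[R] Q (a + 1)} {x : ℕ → R} {n : ℕ}

/-- If `π a ∘ g` is a coboundary then `g` is a coboundary up to a multiple of `x a`. -/
lemma IsLocallyRegularTower.exists_sub_smul_mem_coboundaries
    (hQ : IsLocallyRegularTower p Q π x n) [∀ i, Module.Projective R (P i)] {a : ℕ} (ha : a < n)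
    {i : ℕ} (g : P i →ₗ[R] Q a) (hg : π a ∘ₗ g ∈ coboundaries d (Q (a + 1)) i) :
    ∃ k : P i →ₗ[R] Q a, g - x a • k ∈ coboundaries d (Q a) i := by
  suffices ∃ h ∈ coboundaries d (Q a) i, π a ∘ₗ (g - h) = 0 by
    obtain ⟨h, hh, h0⟩ := this
    obtain ⟨k, hk⟩ := exists_smul_eq_of_forall_exists (x a) (g - h) fun y ↦
      (hQ.map_eq_zero_iff a ha _).1 (LinearMap.congr_fun h0 y)
    exact ⟨k, by rwa [← hk, sub_sub_cancel]⟩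
  cases i with
  | zero => exact ⟨0, Submodule.zero_mem _, by simpa [coboundaries] using hg⟩
  | succ i =>
    obtain ⟨h, hh⟩ := hg
    obtain ⟨h', rfl⟩ := Module.projective_lifting_property (π a) h (hQ.surjective a ha)
    refine ⟨h' ∘ₗ d i, ⟨h', rfl⟩, ?_⟩
    rw [LinearMap.comp_sub, ← hh, sub_eq_zero]
    rfl

lemma comp_eq_zero_of_mem_coboundaries (hd : ∀ i, d i ∘ₗ d (i + 1) = 0) {M : Type}
    [AddCommGroup M] [Module R M] {i : ℕ} {f : P i →ₗ[R] M} (hf : f ∈ coboundaries d M i) :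
    f ∘ₗ d i = 0 := by
  cases i with
  | zero =>
    obtain rfl : f = 0 := hf
    simp
  | succ i =>
    obtain ⟨g, rfl⟩ := hf
    change (g ∘ₗ d i) ∘ₗ d (i + 1) = 0
    rw [LinearMap.comp_assoc, hd, LinearMap.comp_zero]

lemma comp_mem_coboundaries {M M' : Type} [AddCommGroup M] [Module R M] [AddCommGroup M']
    [Module R M'] (φ : M →ₗ[R] M') {i : ℕ} {f : P i →ₗ[R] M} (hf : f ∈ coboundaries d M i) :
    φ ∘ₗ f ∈ coboundaries d M' i := by
  cases i with
  | zero =>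
    obtain rfl : f = 0 := hf
    exact LinearMap.comp_zero φ
  | succ i =>
    obtain ⟨g, rfl⟩ := hf
    exact ⟨φ ∘ₗ g, rfl⟩

/-- If `g ∘ d` is a multiple of `x a` then the reduction of `g` modulo `x a` is a cocycle. -/
lemma IsLocallyRegularTower.comp_comp_eq_zero (hQ : IsLocallyRegularTower p Q π x n) {a : ℕ}
    (ha : a < n) {i : ℕ} {g : P i →ₗ[R] Q a} {f : P (i + 1) →ₗ[R] Q a} (h : x a • f = g ∘ₗ d i) :
    (π a ∘ₗ g) ∘ₗ d i = 0 := by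
  ext y
  refine (hQ.map_eq_zero_iff a ha _).2 ⟨f y, ?_⟩
  exact LinearMap.congr_fun h y

lemma IsLocallyRegularTower.exists_smul_eq_zero_of_smul_eq_zero
    (hQ : IsLocallyRegularTower p Q π x n) {a : ℕ} (ha : a < n) (i : ℕ) :
    ∃ s ∉ p, ∀ f : P i →ₗ[R] Q a, x a • f = 0 → s • f = 0 := by
  obtain ⟨s, hs, h⟩ := hQ.regular a ha
  exact ⟨s, hs, fun f hf ↦ LinearMap.ext fun y ↦ h _ (LinearMap.congr_fun hf y)⟩

lemma exists_smul_mem_of_pow_smul_mem [p.IsPrime] {E : Type} [AddCommGroup E] [Module R E]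
    {B : Submodule R E} {x : R} (h : ∀ f : E, x • f ∈ B → ∃ s ∉ p, s • f ∈ B) (t : ℕ) (f : E)
    (hf : x ^ t • f ∈ B) : ∃ s ∉ p, s • f ∈ B := by
  induction t generalizing f with
  | zero => exact ⟨1, (Ideal.ne_top_iff_one p).1 (Ideal.IsPrime.ne_top ‹_›), by simpa using hf⟩
  | succ t ih =>
    obtain ⟨s, hs, hsf⟩ := h (x ^ t • f) (by rwa [smul_smul, ← pow_succ'])
    obtain ⟨s', hs', hsf'⟩ := ih (s • f) (by rwa [smul_comm])
    exact ⟨s' * s, fun h ↦ (Ideal.IsPrime.mem_or_mem ‹_› h).elim hs' hs, by rwa [mul_smul]⟩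

lemma IsLocallyRegularTower.exists_smul_mem_coboundaries_of_smul_eq [p.IsPrime]
    (hQ : IsLocallyRegularTower p Q π x n) [∀ i, Module.Projective R (P i)]
    (hd : ∀ i, d i ∘ₗ d (i + 1) = 0) {a : ℕ} (ha : a < n) {i : ℕ} {f : P (i + 1) →ₗ[R] Q a}
    {g : P i →ₗ[R] Q a} (hg : x a • f = g ∘ₗ d i)
    {s : R} (hs : s ∉ p) (hsg : s • (π a ∘ₗ g) ∈ coboundaries d (Q (a + 1)) i) :
    ∃ s ∉ p, s • f ∈ coboundaries d (Q a) (i + 1) := by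
  rw [← LinearMap.comp_smul] at hsg
  obtain ⟨k, hk⟩ := hQ.exists_sub_smul_mem_coboundaries ha _ hsg
  obtain ⟨s', hs', hsx⟩ := hQ.exists_smul_eq_zero_of_smul_eq_zero (P := P) ha (i + 1)
  refine ⟨s' * s, fun h ↦ (Ideal.IsPrime.mem_or_mem ‹_› h).elim hs' hs, s' • k, ?_⟩
  have h0 := comp_eq_zero_of_mem_coboundaries hd hk
  rw [LinearMap.sub_comp, LinearMap.smul_comp, LinearMap.smul_comp, ← hg, smul_comm s,
    ← smul_sub] at h0
  have := hsx _ h0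
  rw [smul_sub, sub_eq_zero, smul_smul] at this
  exact this.symm

/-- The cohomology of `Hom(P, Q a)` vanishes locally at `p` in degrees `i` with `i + a < n`. -/
theorem IsLocallyRegularTower.exists_smul_mem_coboundaries [p.IsPrime]
    (hQ : IsLocallyRegularTower p Q π x n) [∀ i, Module.Projective R (P i)]
    (hd : ∀ i, d i ∘ₗ d (i + 1) = 0)
    (hkill : ∀ a < n, ∃ t : ℕ, ∀ (i : ℕ) (f : P i →ₗ[R] Q a), f ∘ₗ d i = 0 →
      x a ^ t • f ∈ coboundaries d (Q a) i)
    (i : ℕ) : ∀ a, i + a < n → ∀ f : P i →ₗ[R] Q a, f ∘ₗ d i = 0 →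
      ∃ s ∉ p, s • f ∈ coboundaries d (Q a) i := by
  induction i with
  | zero =>
    intro a ha f hf
    obtain ⟨t, ht⟩ := hkill a (by omega)
    obtain ⟨s, hs, hsx⟩ := hQ.exists_smul_eq_zero_of_smul_eq_zero (P := P) (a := a) (by omega) 0
    exact exists_smul_mem_of_pow_smul_mem (fun f hf ↦ ⟨s, hs, hsx f hf⟩) t f (ht 0 f hf)
  | succ i ih =>
    intro a ha f hf
    obtain ⟨t, ht⟩ := hkill a (by omega)
    refine exists_smul_mem_of_pow_smul_mem (fun f hf ↦ ?_) t f (ht (i + 1) f hf)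
    obtain ⟨g, hg⟩ := hf
    obtain ⟨s, hs, hsg⟩ := ih (a + 1) (by omega) (π a ∘ₗ g)
      (hQ.comp_comp_eq_zero (by omega) hg.symm)
    exact hQ.exists_smul_mem_coboundaries_of_smul_eq hd (by omega) hg.symm hs hsg

/-- The annihilator of `f` modulo `B` agrees with `p` locally at `p`. -/
structure HasLocalAnnihilator {E : Type} [AddCommGroup E] [Module R E] (p : Ideal R)
    (B : Submodule R E) (f : E) : Prop where
  mem_of_smul_mem : ∀ r, r • f ∈ B → r ∈ p
  exists_smul_mem : ∀ r ∈ p, ∃ s ∉ p, s • r • f ∈ B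

lemma HasLocalAnnihilator.isAssociatedPrime [IsNoetherianRing R] [hp : p.IsPrime] {M : Type}
    [AddCommGroup M] [Module R M] {m : M} (h : HasLocalAnnihilator p (⊥ : Submodule R M) m) :
    IsAssociatedPrime p M := by
  suffices ∃ s ∉ p, ∀ r ∈ p, s • r • m = 0 by
    obtain ⟨s, hs, h'⟩ := this
    refine isAssociatedPrime_iff.2 ⟨hp, s • m, ?_⟩
    ext r
    rw [Submodule.mem_colon_singleton, Submodule.mem_bot]
    refine ⟨fun hr ↦ by rw [smul_comm]; exact h' r hr, fun hr ↦ ?_⟩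
    exact (hp.mem_or_mem (h.mem_of_smul_mem (r * s) (by simpa [mul_smul] using hr))).resolve_right hs
  have key : ∀ q : Ideal R, q.FG → q ≤ p → ∃ s ∉ p, ∀ r ∈ q, s • r • m = 0 := by
    intro q hq
    induction q, hq using Submodule.fg_induction with
    | singleton y =>
      intro hy
      obtain ⟨s, hs, hsy⟩ := h.exists_smul_mem y (hy (Submodule.mem_span_singleton_self y))
      refine ⟨s, hs, fun r hr ↦ ?_⟩
      obtain ⟨c, rfl⟩ := Submodule.mem_span_singleton.1 hr
      rw [smul_assoc, smul_comm s, (Submodule.mem_bot R).1 hsy, smul_zero]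
    | sup q₁ q₂ _ _ h₁ h₂ =>
      intro hq
      obtain ⟨s₁, hs₁, h₁⟩ := h₁ (le_sup_left.trans hq)
      obtain ⟨s₂, hs₂, h₂⟩ := h₂ (le_sup_right.trans hq)
      refine ⟨s₁ * s₂, fun h ↦ (hp.mem_or_mem h).elim hs₁ hs₂, fun r hr ↦ ?_⟩
      obtain ⟨r₁, hr₁, r₂, hr₂, rfl⟩ := Submodule.mem_sup.1 hr
      rw [add_smul, smul_add, mul_smul, mul_smul, h₂ r₂ hr₂, smul_comm s₁, h₁ r₁ hr₁, smul_zero,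
        smul_zero, add_zero]
  exact key p (IsNoetherian.noetherian p) le_rfl

/-- A cohomology class of `Hom(P, Q a)` in degree `i` with local annihilator `p` descends to a
cocycle of degree `0` with values in `Q (a + i)` with the same property. -/
theorem IsLocallyRegularTower.exists_hasLocalAnnihilator [hp : p.IsPrime]
    (hQ : IsLocallyRegularTower p Q π x n) [∀ i, Module.Projective R (P i)]
    (hd : ∀ i, d i ∘ₗ d (i + 1) = 0)
    (hkill : ∀ a < n, ∃ t : ℕ, ∀ (i : ℕ) (f : P i →ₗ[R] Q a), f ∘ₗ d i = 0 →
      x a ^ t • f ∈ coboundaries d (Q a) i)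
    (i : ℕ) : ∀ a, i + a = n → ∀ f : P i →ₗ[R] Q a, f ∘ₗ d i = 0 →
      HasLocalAnnihilator p (coboundaries d (Q a) i) f →
      ∃ g : P 0 →ₗ[R] Q n, g ∘ₗ d 0 = 0 ∧ HasLocalAnnihilator p ⊥ g := by
  induction i with
  | zero =>
    rintro a ha f hf h
    obtain rfl : a = n := by omega
    exact ⟨f, hf, h⟩
  | succ i ih =>
    intro a ha f hf h
    have ha' : a < n := by omega
    obtain ⟨t, ht⟩ := hkill a ha'
    have hx : x a ∈ p := hp.mem_of_pow_mem _ (h.mem_of_smul_mem _ (ht _ f hf))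
    obtain ⟨s, hs, g, hg⟩ := h.exists_smul_mem _ hx
    rw [smul_comm] at hg
    have hgc := hQ.comp_comp_eq_zero ha' hg.symm
    refine ih (a + 1) (by omega) (π a ∘ₗ g) hgc ⟨fun r hr ↦ ?_, fun r hr ↦ ?_⟩
    · rw [← LinearMap.comp_smul] at hr
      obtain ⟨s', hs', h'⟩ := hQ.exists_smul_mem_coboundaries_of_smul_eq hd ha' (f := r • s • f)
        (g := r • g) (by rw [smul_comm, ← hg]; rfl) (s := 1)
        ((Ideal.ne_top_iff_one p).1 hp.ne_top) (by rwa [one_smul])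
      rw [smul_smul, smul_smul] at h'
      have := h.mem_of_smul_mem _ h'
      exact (hp.mem_or_mem ((hp.mem_or_mem this).resolve_right hs)).resolve_left hs'
    · obtain ⟨s', hs', l, hl⟩ := h.exists_smul_mem r hr
      change l ∘ₗ d i = _ at hl
      change g ∘ₗ d i = _ at hg
      have hc : (s' • r • g - x a • s • l) ∘ₗ d i = 0 := by
        simp only [LinearMap.sub_comp, LinearMap.smul_comp, hg, hl]
        module
      obtain ⟨s'', hs'', h''⟩ := hQ.exists_smul_mem_coboundaries hd hkill i a (by omega) _ hc
      have hπ := comp_mem_coboundaries (π a) h''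
      have h0 : π a ∘ₗ (x a • s • l) = 0 := by
        ext y
        exact (hQ.map_eq_zero_iff a ha' _).2 ⟨s • l y, rfl⟩
      rw [LinearMap.comp_smul, LinearMap.comp_sub, h0, sub_zero, LinearMap.comp_smul,
        LinearMap.comp_smul, smul_smul] at hπ
      exact ⟨_, fun h ↦ (hp.mem_or_mem h).elim hs'' hs', hπ⟩

end ComplexCohomology

/-- In a Noetherian local ring, passing to a strictly larger prime drops the dimension. -/
lemma ringKrullDim_quotient_lt_of_lt {R : Type} [CommRing R] [IsNoetherianRing R] [IsLocalRing R]
    {q p : Ideal R} [q.IsPrime] (hp : p ≠ ⊤) (h : q < p) :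
    ringKrullDim (R ⧸ p) < ringKrullDim (R ⧸ q) := by
  obtain ⟨hle, y, hyp, hyq⟩ := SetLike.lt_iff_le_and_exists.1 h
  have : Nontrivial (R ⧸ p) := Ideal.Quotient.nontrivial_iff.2 hp
  have : IsLocalRing (R ⧸ q) := .of_surjective' (Ideal.Quotient.mk q) Ideal.Quotient.mk_surjective
  have hle : ringKrullDim (R ⧸ p) ≤
      ringKrullDim ((R ⧸ q) ⧸ Ideal.span {Ideal.Quotient.mk q y}) := by
    refine ringKrullDim_le_of_surjective
      (Ideal.Quotient.lift _ (Ideal.Quotient.factor hle) fun a ha ↦ ?_)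
      (Ideal.Quotient.lift_surjective_of_surjective _ _ (Ideal.Quotient.factor_surjective hle))
    obtain ⟨c, rfl⟩ := Ideal.mem_span_singleton'.1 ha
    simp [Ideal.Quotient.eq_zero_iff_mem.2 hyp]
  have hsucc := ringKrullDim_quotient_succ_le_of_nonZeroDivisor (r := Ideal.Quotient.mk q y)
    (mem_nonZeroDivisors_of_ne_zero fun h ↦ hyq (Ideal.Quotient.eq_zero_iff_mem.1 h))
  have : IsLocalRing (R ⧸ p) := .of_surjective' (Ideal.Quotient.mk p) Ideal.Quotient.mk_surjective
  have htop : ringKrullDim (R ⧸ q) < ⊤ := ringKrullDim_lt_top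
  have hbot : ringKrullDim (R ⧸ p) ≠ ⊥ := ringKrullDim_ne_bot
  generalize ringKrullDim (R ⧸ p) = a at *
  generalize ringKrullDim (R ⧸ q) = b at *
  have := (add_le_add_left hle 1).trans hsucc
  clear hle hsucc
  induction a with
  | bot => exact absurd rfl hbot
  | coe a =>
    induction b with
    | bot => simp at this
    | coe b =>
      have hb : b < ⊤ := by exact WithBot.coe_lt_coe.1 htop
      have h1 : a + 1 ≤ b := by exact_mod_cast this
      have : a < b := ENat.add_one_le_iff (by rintro rfl; simp at h1; exact hb.ne h1) |>.1 h1
      exact_mod_cast this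

/-- An element outside all associated primes contained in `p` is regular locally at `p`. -/
lemma exists_forall_smul_eq_zero_of_forall_associatedPrimes {R M : Type} [CommRing R]
    [IsNoetherianRing R] [AddCommGroup M] [Module R M] [Module.Finite R M] {p : Ideal R}
    [p.IsPrime] {x : R} (h : ∀ q ∈ associatedPrimes R M, q ≤ p → x ∉ q) :
    ∃ s ∉ p, ∀ m : M, x • m = 0 → s • m = 0 := by
  by_contra! hs
  let K := LinearMap.ker (LinearMap.lsmul R M x)
  have hK : Module.annihilator R K ≤ p := by
    intro s hsK
    by_contra hsp
    obtain ⟨m, hm, hm'⟩ := hs s hsp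
    exact hm' (congrArg Subtype.val (Module.mem_annihilator.1 hsK ⟨m, hm⟩))
  obtain ⟨q, hq, hqp⟩ := Ideal.exists_minimalPrimes_le hK
  refine h q ?_ hqp (hq.1.2 (Module.mem_annihilator.2 fun m ↦ Subtype.ext m.2))
  exact IsAssociatedPrime.map_of_injective K.subtype
    (Module.associatedPrimes.minimalPrimes_annihilator_subset_associatedPrimes R K hq)
    K.injective_subtype

lemma prefIdeal_mono {R : Type} [CommRing R] {r : ℕ} (x : Fin r → R) : Monotone (prefIdeal x) :=
  fun _ _ h ↦ Ideal.span_mono (Set.image_mono fun _ hi ↦ lt_of_lt_of_le hi h)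

lemma prefIdeal_zero {R : Type} [CommRing R] {r : ℕ} (x : Fin r → R) : prefIdeal x 0 = ⊥ := by
  simp [prefIdeal]

lemma prefIdeal_succ {R : Type} [CommRing R] {r : ℕ} (x : Fin r → R) (a : Fin r) :
    prefIdeal x (a + 1) = prefIdeal x a ⊔ Ideal.span {x a} := by
  rw [prefIdeal, prefIdeal, ← Ideal.span_union, ← Set.image_singleton, ← Set.image_union]
  congr 2
  ext i
  simp only [Set.mem_ofPred_eq, Set.mem_union, Set.mem_singleton_iff, Fin.ext_iff]
  omega

/-- Away from the associated primes of the successive quotients, a sequence in dimension `> k` is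
regular locally at primes of dimension `≥ k`. -/
lemma IsSeqInDimGT.isLocallyRegularTower {R : Type} [CommRing R] [IsNoetherianRing R]
    [IsLocalRing R] {N : Type} [AddCommGroup N] [Module R N] [Module.Finite R N] {k : ℤ} {r : ℕ}
    {x : Fin r → R} (hx : IsSeqInDimGT R N k x) {p : Ideal R} [p.IsPrime] (hp : p ∈ dimGE R k)
    {j : ℕ} (hj : j ≤ r)
    (hass : ∀ i < j, p ∉ associatedPrimes R (N ⧸ (prefIdeal x i • ⊤ : Submodule R N))) :
    ComplexCohomology.IsLocallyRegularTower p
      (fun i ↦ N ⧸ (prefIdeal x i • ⊤ : Submodule R N))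
      (fun i ↦ Submodule.factor (Submodule.smul_mono_left (prefIdeal_mono x i.le_succ)))
      (fun i ↦ if h : i < r then x ⟨i, h⟩ else 0) j where
  surjective a _ := Submodule.factor_surjective _
  map_eq_zero_iff a ha m := by
    have har : a < r := by omega
    rw [dif_pos har]
    obtain ⟨m, rfl⟩ := Submodule.mkQ_surjective _ m
    have := prefIdeal_succ x ⟨a, har⟩
    simp only at this
    have key : ∀ m : N, m ∈ (prefIdeal x (a + 1) • ⊤ : Submodule R N) ↔
        ∃ m', m - x ⟨a, har⟩ • m' ∈ (prefIdeal x a • ⊤ : Submodule R N) := by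
      intro m
      rw [this, Submodule.sup_smul, Submodule.mem_sup]
      constructor
      · rintro ⟨u, hu, v, hv, rfl⟩
        obtain ⟨m', -, rfl⟩ := Submodule.mem_smul_pointwise_iff_exists _ _ _ |>.1
          (Submodule.ideal_span_singleton_smul (x ⟨a, har⟩) (⊤ : Submodule R N) ▸ hv)
        exact ⟨m', by simpa using hu⟩
      · rintro ⟨m', hm'⟩
        exact ⟨_, hm', _, Submodule.smul_mem_smul (Ideal.mem_span_singleton_self _)
          (Submodule.mem_top (x := m')), by simp⟩
    change Submodule.Quotient.mk m = 0 ↔ _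
    rw [Submodule.Quotient.mk_eq_zero, key]
    refine ⟨fun ⟨m', h⟩ ↦ ⟨Submodule.Quotient.mk m', ?_⟩, fun ⟨m', h⟩ ↦ ?_⟩
    · rw [← Submodule.Quotient.mk_smul]
      exact ((Submodule.Quotient.eq _).2 h).symm
    · obtain ⟨m', rfl⟩ := Submodule.mkQ_surjective _ m'
      exact ⟨m', (Submodule.Quotient.eq _).1 h.symm⟩
  regular a ha := by
    have har : a < r := by omega
    rw [dif_pos har]
    refine exists_forall_smul_eq_zero_of_forall_associatedPrimes fun q hq hqp ↦
      hx ⟨a, har⟩ q hq ?_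
    have := hq.isPrime
    exact lt_of_le_of_lt hp (ringKrullDim_quotient_lt_of_lt (Ideal.IsPrime.ne_top ‹_›)
      (lt_of_le_of_ne hqp fun h ↦ hass a ha (h ▸ hq)))

lemma exists_isSeqInDimGT_of_depthK_eq {R : Type} [CommRing R] {k : ℤ} {I : Ideal R} {N : Type}
    [AddCommGroup N] [Module R N] {r : ℕ} (hr : depthK R k I N = r) :
    ∃ x : Fin r → R, (∀ i, x i ∈ I) ∧ IsSeqInDimGT R N k x := by
  have hne : Nonempty {n : ℕ∞ | ∃ (r : ℕ) (x : Fin r → R),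
      (∀ i, x i ∈ I) ∧ IsSeqInDimGT R N k x ∧ n = (r : ℕ∞)} :=
    ⟨0, 0, Fin.elim0, fun i ↦ i.elim0, fun i ↦ i.elim0, rfl⟩
  have hmem := ENat.sSup_mem_of_nonempty_of_lt_top (lt_of_eq_of_lt hr (ENat.natCast_lt_top r))
  obtain ⟨r', x, hxI, hx, h⟩ := hmem
  obtain rfl : r = r' := by exact_mod_cast hr.symm.trans h
  exact ⟨x, hxI, hx⟩

namespace ComplexCohomology

/-- The properties of a projective resolution `P` of a cyclic module `R ⧸ J` used below. -/
structure ResolvesCyclic {R : Type} [CommRing R] {P : ℕ → Type} [∀ i, AddCommGroup (P i)]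
    [∀ i, Module R (P i)] (d : ∀ i, P (i + 1) →ₗ[R] P i) (J : Ideal R) : Prop where
  projective : ∀ i, Module.Projective R (P i)
  d_comp_d : ∀ i, d i ∘ₗ d (i + 1) = 0
  smul_mem_coboundaries : ∀ c ∈ J, ∀ (M : Type) [AddCommGroup M] [Module R M] (i : ℕ)
    (f : P i →ₗ[R] M), f ∘ₗ d i = 0 → c • f ∈ coboundaries d M i
  exists_generator : ∃ e : P 0, ∀ (M : Type) [AddCommGroup M] [Module R M] (f : P 0 →ₗ[R] M),
    f ∘ₗ d 0 = 0 → f e = 0 → f = 0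

/-- If `p` is the annihilator of a class in `Ext^j(R ⧸ I ^ t, N)` and `dim (R ⧸ p) ≥ k`, then `p` is
associated to `N ⧸ (x₁, …, xᵢ) N` for some `i ≤ j`. -/
theorem ResolvesCyclic.exists_mem_associatedPrimes {R : Type} [CommRing R] [IsNoetherianRing R]
    [IsLocalRing R] {P : ℕ → Type} [∀ i, AddCommGroup (P i)] [∀ i, Module R (P i)]
    {d : ∀ i, P (i + 1) →ₗ[R] P i} {I : Ideal R} {t : ℕ} (hP : ResolvesCyclic d (I ^ t))
    {N : Type} [AddCommGroup N] [Module R N] [Module.Finite R N] {k : ℤ} {r : ℕ}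
    {x : Fin r → R} (hxI : ∀ i, x i ∈ I) (hx : IsSeqInDimGT R N k x) {p : Ideal R} [p.IsPrime]
    (hp : p ∈ dimGE R k) {j : ℕ} (hj : j ≤ r) (f : P j →ₗ[R] N) (hf : f ∘ₗ d j = 0)
    (hann : ∀ c, c • f ∈ coboundaries d N j ↔ c ∈ p) :
    ∃ i ≤ j, p ∈ associatedPrimes R (N ⧸ (prefIdeal x i • ⊤ : Submodule R N)) := by
  by_contra! hass
  have := hP.projective
  have hQ := hx.isLocallyRegularTower hp hj fun i hi ↦ hass i hi.le
  let e : N ≃ₗ[R] N ⧸ (prefIdeal x 0 • ⊤ : Submodule R N) :=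
    (Submodule.quotEquivOfEqBot _ (by rw [prefIdeal_zero, Submodule.bot_smul])).symm
  have he : HasLocalAnnihilator p (coboundaries d _ j) (e.toLinearMap ∘ₗ f) := by
    refine ⟨fun c hc ↦ ?_,
      fun c hc ↦ ⟨1, (Ideal.ne_top_iff_one p).1 (Ideal.IsPrime.ne_top ‹_›), ?_⟩⟩
    · have := comp_mem_coboundaries e.symm.toLinearMap hc
      rw [← LinearMap.comp_smul, ← LinearMap.comp_assoc, LinearEquiv.comp_coe] at this
      exact (hann c).1 (by simpa using this)
    · rw [one_smul, ← LinearMap.comp_smul]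
      exact comp_mem_coboundaries _ ((hann c).2 hc)
  obtain ⟨g, hg, hgp⟩ := hQ.exists_hasLocalAnnihilator (d := d) hP.d_comp_d
    (fun a ha ↦ ⟨t, fun i f hf ↦ hP.smul_mem_coboundaries _
      (Ideal.pow_mem_pow (by rw [dif_pos (by omega : a < r)]; exact hxI _) t) _ i f hf⟩) j 0 rfl
    (e.toLinearMap ∘ₗ f) (by rw [LinearMap.comp_assoc, hf, LinearMap.comp_zero]) he
  obtain ⟨y, hy⟩ := hP.exists_generator
  refine hass j le_rfl (HasLocalAnnihilator.isAssociatedPrime (m := g y)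
    ⟨fun c hc ↦ hgp.mem_of_smul_mem c ?_, fun c hc ↦ ?_⟩)
  · exact hy _ (c • g) (by rw [LinearMap.smul_comp, hg, smul_zero]) hc
  · obtain ⟨s, hs, h⟩ := hgp.exists_smul_mem c hc
    exact ⟨s, hs, LinearMap.congr_fun h y⟩

open Limits

/-- A projective resolution of `R ⧸ J` in the category of modules, as a sequence of linear maps. -/
theorem resolvesCyclic_projectiveResolution {R : Type} [CommRing R] (J : Ideal R)
    (P : ProjectiveResolution (ModuleCat.of R (R ⧸ J))) :
    ResolvesCyclic (P := fun i ↦ P.complex.X i) (fun i ↦ (P.complex.d (i + 1) i).hom) J where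
  projective i := (IsProjective.iff_projective _).2 (P.projective i)
  d_comp_d i := by
    rw [← ModuleCat.hom_comp, P.complex.d_comp_d, ModuleCat.hom_zero]
  smul_mem_coboundaries c hc M _ _ i f hf := by
    have hzero : (c • 𝟙 P.complex) ≫ P.π = 0 := by
      apply HomologicalComplex.to_single_hom_ext
      let π₀ : P.complex.X 0 ⟶ ModuleCat.of R (R ⧸ J) := P.π.f 0
      have : c • π₀ = 0 := by
        ext y
        obtain ⟨z, hz⟩ := Ideal.Quotient.mk_surjective (I := J) (π₀ y)
        change c • π₀ y = 0
        rw [← hz, ← Ideal.Quotient.mk_eq_mk, ← Submodule.Quotient.mk_smul,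
          Submodule.Quotient.mk_eq_zero]
        exact J.mul_mem_right z hc
      rw [HomologicalComplex.comp_f, HomologicalComplex.smul_f_apply, HomologicalComplex.id_f,
        Linear.smul_comp, Category.id_comp]
      exact this
    let h := ProjectiveResolution.liftHomotopyZero _ hzero
    have hcomm := congrArg ModuleCat.Hom.hom (h.comm i)
    rw [Homotopy.prevD_chainComplex] at hcomm
    cases i with
    | zero =>
      rw [Homotopy.dNext_zero_chainComplex] at hcomm
      change c • f = 0
      ext y
      have := congrArg f (LinearMap.congr_fun hcomm y)
      have hf' : ∀ z, f ((P.complex.d 1 0).hom z) = 0 := LinearMap.congr_fun hf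
      simpa [hf'] using this
    | succ i =>
      rw [Homotopy.dNext_succ_chainComplex] at hcomm
      refine ⟨f ∘ₗ (h.hom i (i + 1)).hom, ?_⟩
      ext y
      have := congrArg f (LinearMap.congr_fun hcomm y)
      have hf' : ∀ z, f ((P.complex.d (i + 1 + 1) (i + 1)).hom z) = 0 := LinearMap.congr_fun hf
      simpa [hf'] using this.symm
  exists_generator := by
    let π₀ : P.complex.X 0 ⟶ ModuleCat.of R (R ⧸ J) := P.π.f 0
    have hsurj : Function.Surjective π₀ :=
      (ModuleCat.epi_iff_surjective _).1 (inferInstanceAs (Epi (P.π.f 0)))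
    have hexact : ∀ y, π₀ y = 0 → ∃ z, P.complex.d 1 0 z = y :=
      (ShortComplex.moduleCat_exact_iff _).1 P.exact₀
    obtain ⟨e, he⟩ := hsurj (Ideal.Quotient.mk J 1)
    refine ⟨e, fun M _ _ f hf hfe ↦ LinearMap.ext fun y ↦ ?_⟩
    obtain ⟨c, hc⟩ := Ideal.Quotient.mk_surjective (π₀ y)
    obtain ⟨z, hz⟩ := hexact (y - c • e) (by
      rw [map_sub, map_smul, he, ← hc, sub_eq_zero, ← Ideal.Quotient.mk_eq_mk,
        ← Ideal.Quotient.mk_eq_mk, ← Submodule.Quotient.mk_smul, smul_eq_mul, mul_one])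
    have h0 : f (P.complex.d 1 0 z) = 0 := LinearMap.congr_fun hf z
    rw [hz, map_sub, map_smul, hfe, smul_zero, sub_zero] at h0
    exact h0

/-- Elements of `Ext` are represented by cocycles on a projective resolution. -/
theorem exists_cocycle_of_mem_associatedPrimes_ext {R : Type} [CommRing R] [IsNoetherianRing R]
    {A N : ModuleCat.{0} R} (P : ProjectiveResolution A) (j : ℕ) {p : Ideal R}
    (hp : p ∈ associatedPrimes R (((Ext R (ModuleCat R) j).obj (op A)).obj N)) :
    ∃ f : P.complex.X j →ₗ[R] N, f ∘ₗ (P.complex.d (j + 1) j).hom = 0 ∧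
      ∀ c, c • f ∈ coboundaries (P := fun i ↦ P.complex.X i)
        (fun i ↦ (P.complex.d (i + 1) i).hom) N j ↔ c ∈ p := by
  let K := P.complex.linearYonedaObj R N
  have hp' : IsAssociatedPrime p (K.homology j) :=
    hp.map_of_injective (P.isoExt j N).toLinearEquiv.toLinearMap
      (P.isoExt j N).toLinearEquiv.injective
  obtain ⟨-, z, hz⟩ := isAssociatedPrime_iff.1 hp'
  obtain ⟨y, rfl⟩ := (ModuleCat.epi_iff_surjective (K.homologyπ j)).1 inferInstance z
  have hinj : Function.Injective (K.iCycles j) := (ModuleCat.mono_iff_injective _).1 inferInstance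
  let f : P.complex.X j ⟶ N := K.iCycles j y
  have hf : P.complex.d (j + 1) j ≫ f = 0 :=
    LinearMap.congr_fun (congrArg ModuleCat.Hom.hom (K.iCycles_d j (j + 1))) y
  have key : ∀ w : K.cycles j, K.homologyπ j w = 0 ↔
      (K.iCycles j w : P.complex.X j ⟶ N).hom ∈ coboundaries (P := fun i ↦ P.complex.X i)
        (fun i ↦ (P.complex.d (i + 1) i).hom) N j := by
    intro w
    cases j with
    | zero =>
      have hex := (ShortComplex.moduleCat_exact_iff _).1 (ShortComplex.exact_of_g_is_cokernel
        (.mk _ _ (K.toCycles_comp_homologyπ 0 0))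
        (K.homologyIsCokernel 0 0 CochainComplex.prev_nat_zero))
      have hzero : K.toCycles 0 0 = 0 := K.toCycles_eq_zero (by simp)
      refine ⟨fun h ↦ ?_, fun h ↦ ?_⟩
      · obtain ⟨g, hg⟩ := hex w h
        change K.toCycles 0 0 g = w at hg
        rw [← hg, hzero]
        change (K.iCycles 0 0 : P.complex.X 0 ⟶ N).hom = 0
        rw [map_zero]
        rfl
      · have : K.iCycles 0 w = 0 := ModuleCat.hom_ext h
        rw [hinj (this.trans (map_zero (K.iCycles 0).hom).symm), map_zero]
    | succ j =>
      have hex := (ShortComplex.moduleCat_exact_iff _).1 (ShortComplex.exact_of_g_is_cokernel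
        (.mk _ _ (K.toCycles_comp_homologyπ j (j + 1)))
        (K.homologyIsCokernel j (j + 1) (CochainComplex.prev_nat_succ j)))
      have hi (g : P.complex.X j ⟶ N) :
          K.iCycles (j + 1) (K.toCycles j (j + 1) g) = P.complex.d (j + 1) j ≫ g :=
        LinearMap.congr_fun (congrArg ModuleCat.Hom.hom (K.toCycles_i j (j + 1))) g
      refine ⟨fun h ↦ ?_, fun ⟨g, hg⟩ ↦ ?_⟩
      · obtain ⟨g, hg⟩ := hex w h
        change K.toCycles j (j + 1) g = w at hg
        rw [← hg]
        let g' : P.complex.X j ⟶ N := g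
        exact ⟨g'.hom, (congrArg ModuleCat.Hom.hom (hi g)).symm⟩
      · have : w = K.toCycles j (j + 1) (ModuleCat.ofHom g : P.complex.X j ⟶ N) :=
          hinj ((ModuleCat.hom_ext hg.symm).trans (hi _).symm)
        rw [this]
        exact LinearMap.congr_fun
          (congrArg ModuleCat.Hom.hom (K.toCycles_comp_homologyπ j (j + 1))) _
  refine ⟨f.hom, congrArg ModuleCat.Hom.hom hf, fun c ↦ ?_⟩
  rw [hz, Submodule.mem_colon_singleton, Submodule.mem_bot, ← map_smul, key, map_smul]
  rfl

/-- An associated prime of a filtered colimit is an associated prime of some stage. -/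
theorem exists_mem_associatedPrimes_of_mem_colimit {R : Type} [CommRing R] [IsNoetherianRing R]
    {D : Type} [SmallCategory D] [IsFiltered D] (F : D ⥤ ModuleCat.{0} R) {p : Ideal R}
    (hp : p ∈ associatedPrimes R (colimit F : ModuleCat.{0} R)) :
    ∃ i, p ∈ associatedPrimes R (F.obj i) := by
  obtain ⟨hp, z, hz⟩ := isAssociatedPrime_iff.1 hp
  obtain ⟨i, y, rfl⟩ := Concrete.colimit_exists_rep F z
  have hker : ∀ q : Ideal R, q.FG → q ≤ p → ∃ (i' : D) (φ : i ⟶ i'), ∀ c ∈ q,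
      c • F.map φ y = 0 := by
    intro q hq
    induction q, hq using Submodule.fg_induction with
    | singleton c =>
      intro hc
      have hcy : colimit.ι F i (c • y) = 0 := by
        have := hc (Submodule.mem_span_singleton_self c)
        rwa [hz, Submodule.mem_colon_singleton, Submodule.mem_bot, ← map_smul] at this
      obtain ⟨i', φ, hφ⟩ := Concrete.colimit_rep_eq_zero R F i _ hcy
      refine ⟨i', φ, fun b hb ↦ ?_⟩
      obtain ⟨a, rfl⟩ := Submodule.mem_span_singleton.1 hb
      rw [smul_assoc, ← map_smul]
      exact (congrArg (a • ·) hφ).trans (smul_zero a)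
    | sup q₁ q₂ _ _ h₁ h₂ =>
      intro hq
      obtain ⟨i₁, φ₁, h₁⟩ := h₁ (le_sup_left.trans hq)
      obtain ⟨i₂, φ₂, h₂⟩ := h₂ (le_sup_right.trans hq)
      obtain ⟨i', ψ₁, ψ₂, hψ⟩ := IsFiltered.span φ₁ φ₂
      refine ⟨i', φ₁ ≫ ψ₁, fun c hc ↦ ?_⟩
      obtain ⟨c₁, hc₁, c₂, hc₂, rfl⟩ := Submodule.mem_sup.1 hc
      have e₁ : c₁ • F.map (φ₁ ≫ ψ₁) y = 0 := by
        rw [F.map_comp, ModuleCat.comp_apply, ← map_smul, h₁ c₁ hc₁, map_zero]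
      have e₂ : c₂ • F.map (φ₁ ≫ ψ₁) y = 0 := by
        rw [hψ, F.map_comp, ModuleCat.comp_apply, ← map_smul, h₂ c₂ hc₂, map_zero]
      rw [add_smul, e₁, e₂, add_zero]
  obtain ⟨i', φ, hφ⟩ := hker p (IsNoetherian.noetherian p) le_rfl
  refine ⟨i', isAssociatedPrime_iff.2 ⟨hp, F.map φ y, ?_⟩⟩
  ext c
  rw [Submodule.mem_colon_singleton, Submodule.mem_bot]
  refine ⟨hφ c, fun hc ↦ ?_⟩
  rw [hz, Submodule.mem_colon_singleton, Submodule.mem_bot, ← colimit.w F φ,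
    ModuleCat.comp_apply, ← map_smul, hc, map_zero]

end ComplexCohomology

/-- If `r = depth_k(I,N) < ∞`, then for every `j ≤ r` the set
`{p ∈ Ass_R(H^j_I(N)) : dim(R/p) ≥ k}` is finite. -/
theorem ass_localCohomology_finite (R : Type) [CommRing R] [IsNoetherianRing R] [IsLocalRing R]
    (I : Ideal R) (N : Type) [AddCommGroup N] [Module R N] [Module.Finite R N]
    (k : ℤ) (hk : -1 ≤ k) (r : ℕ) (hr : depthK R k I N = (r : ℕ∞))
    (j : ℕ) (hj : j ≤ r) :
    (associatedPrimes R ((localCohomology I j).obj (ModuleCat.of R N)) ∩ dimGE R k).Finite := by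
  obtain ⟨x, hxI, hx⟩ := exists_isSeqInDimGT_of_depthK_eq hr
  refine Set.Finite.subset ((Set.finite_Iic j).biUnion fun i _ ↦
    associatedPrimes.finite R (N ⧸ (prefIdeal x i • ⊤ : Submodule R N))) ?_
  rintro p ⟨hp, hpk⟩
  have : p.IsPrime := hp.isPrime
  let F := localCohomology.diagram (localCohomology.idealPowersDiagram I) j ⋙
    (evaluation (ModuleCat R) (ModuleCat R)).obj (ModuleCat.of R N)
  let e : (localCohomology I j).obj (ModuleCat.of R N) ≅ Limits.colimit F :=
    Limits.colimitObjIsoColimitCompEvaluation _ _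
  have : IsFiltered (ℕᵒᵖ)ᵒᵖ := inferInstance
  obtain ⟨t, ht⟩ := ComplexCohomology.exists_mem_associatedPrimes_of_mem_colimit F
    (hp.map_of_injective e.toLinearEquiv.toLinearMap e.toLinearEquiv.injective)
  let P := projectiveResolution (ModuleCat.of R (R ⧸ I ^ t.unop.unop))
  obtain ⟨f, hf, hann⟩ := ComplexCohomology.exists_cocycle_of_mem_associatedPrimes_ext P j ht
  obtain ⟨i, hij, hi⟩ := (ComplexCohomology.resolvesCyclic_projectiveResolution _ P
    ).exists_mem_associatedPrimes hxI hx hpk hj f hf hann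
  exact Set.mem_biUnion (Set.mem_Iic.2 hij) hi
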